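/- Let S = (s_1, ..., s_n) with 0 ≤ s_i ≤ r and s_1 + ... + s_n ≥ rk. Then the chromatic number of the r-uniform hypergraph KG^r_S(n,k) is at least ⌈((s_1+...+s_n) - r(k-1))/(r-1)⌉. -/

import Mathlib

open Finset

/-- A coloring of the vertices is proper if no edge is monochromatic. -/
def IsProperColoring {V : Type*} (E : Set (Multiset V)) {t : ℕ} (c : V → Fin t) : Prop :=
  ∀ e ∈ E, ∃ a ∈ e, ∃ b ∈ e, c a ≠ c b

/-- The chromatic number of a hypergraph with edge set `E`, as an extended natural number
(infinity if no proper coloring exists, e.g. in the presence of a loop edge). -/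
noncomputable def hypChromatic {V : Type*} (E : Set (Multiset V)) : ℕ∞ :=
  sInf {N : ℕ∞ | ∃ t : ℕ, N = (t : ℕ∞) ∧ ∃ c : V → Fin t, IsProperColoring E c}

/-- Vertices of `KG^r_S(n,k)`: the `k`-subsets of `[n]`. -/
def KGSVertex (n k : ℕ) : Type :=
  {A : Finset (Fin n) // A.card = k}

/-- Edges of `KG^r_S(n,k)`: multisets `{A_1, …, A_r}` of `k`-subsets that are `S`-disjoint,
i.e. each `i ∈ [n]` belongs to at most `s i` of the sets. -/
def KGSEdges (n k r : ℕ) (s : Fin n → ℕ) : Set (Multiset (KGSVertex n k)) :=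
  {e | Multiset.card e = r ∧ ∀ x : Fin n, (e.filter fun A => x ∈ A.1).card ≤ s x}

/-! ### Cochains on lists -/

section Cochain

variable {X Y R : Type*} [CommRing R]

/-- The simplicial coboundary of a cochain, simplices being lists of vertices. -/
def coboundary : (List X → R) → List X → R
  | _, [] => 0
  | φ, a :: l => φ l - coboundary (fun m => φ (a :: m)) l

/-- Evaluation of a cochain on the prism between a list and its image under `u`. -/
def prism (u : X → X) : (List X → R) → List X → R
  | _, [] => 0
  | φ, a :: l => φ (a :: u a :: l.map u) - prism u (fun m => φ (a :: m)) l

/-- Evaluation of a cochain on the cone with apex `e` over a list, passing through its image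
under `u`. -/
def cone (u : X → X) (e : X) (φ : List X → R) (l : List X) : R :=
  φ (e :: l.map u) - prism u φ l

/-- The alternating operators `τ - 1` and `1 + τ + ⋯ + τ ^ (p - 1)` on cochains. -/
def alternatingOp (τ : X → X) (p d : ℕ) (φ : List X → R) (l : List X) : R :=
  if Even d then φ (l.map τ) - φ l else ∑ i ∈ range p, φ (l.map τ^[i])

/-- Evaluation of a cochain on the iterated cone of dimension `d`. -/
def iterCone (τ : X → X) (p : ℕ) (u : ℕ → X → X) (e : ℕ → X) : ℕ → (List X → R) → R
  | 0, φ => φ [e 0]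
  | d + 1, φ =>
      iterCone τ p u e d (alternatingOp τ p d (cone (u (d + 1)) (e (d + 1)) φ))

theorem coboundary_sub (φ ψ : List X → R) (l : List X) :
    coboundary (fun m => φ m - ψ m) l = coboundary φ l - coboundary ψ l := by
  induction l generalizing φ ψ with
  | nil => simp [coboundary]
  | cons a l ih => simp only [coboundary, ih]; ring

theorem coboundary_mul_left (c : R) (φ : List X → R) (l : List X) :
    coboundary (fun m => c * φ m) l = c * coboundary φ l := by
  induction l generalizing φ with
  | nil => simp [coboundary]
  | cons a l ih => simp only [coboundary, ih]; ring

theorem coboundary_sum {ι : Type*} (s : Finset ι) (φ : ι → List X → R) (l : List X) :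
    coboundary (fun m => ∑ i ∈ s, φ i m) l = ∑ i ∈ s, coboundary (φ i) l := by
  induction l generalizing φ with
  | nil => simp [coboundary]
  | cons a l ih => simp only [coboundary, ih, Finset.sum_sub_distrib]

theorem coboundary_comp_map (f : X → Y) (φ : List Y → R) (l : List X) :
    coboundary (fun m => φ (m.map f)) l = coboundary φ (l.map f) := by
  induction l generalizing φ with
  | nil => simp [coboundary]
  | cons a l ih => simp only [coboundary, List.map_cons, ih (fun m => φ (f a :: m))]

theorem prism_sub (u : X → X) (φ ψ : List X → R) (l : List X) :
    prism u (fun m => φ m - ψ m) l = prism u φ l - prism u ψ l := by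
  induction l generalizing φ ψ with
  | nil => simp [prism]
  | cons a l ih => simp only [prism, ih]; ring

theorem prism_coboundary (u : X → X) (φ : List X → R) (l : List X) :
    prism u (coboundary φ) l = φ (l.map u) - φ l - coboundary (prism u φ) l := by
  induction l generalizing φ with
  | nil => simp [prism, coboundary]
  | cons a l ih =>
    have h := coboundary_comp_map u (fun m => φ (a :: u a :: m)) l
    simp only [prism, coboundary, prism_sub, ih, List.map_cons, coboundary_sub, h]
    ring

theorem cone_coboundary (u : X → X) (e : X) (φ : List X → R) (l : List X) :
    cone u e (coboundary φ) l = φ l - coboundary (cone u e φ) l := by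
  have h := coboundary_comp_map u (fun m => φ (e :: m)) l
  have h2 : coboundary (cone u e φ) l
      = coboundary (fun m => φ (e :: m.map u)) l - coboundary (prism u φ) l :=
    coboundary_sub _ _ _
  rw [h2, h, cone, prism_coboundary, coboundary]
  ring

theorem alternatingOp_sub (τ : X → X) (p d : ℕ) (φ ψ : List X → R) (l : List X) :
    alternatingOp τ p d (fun m => φ m - ψ m) l
      = alternatingOp τ p d φ l - alternatingOp τ p d ψ l := by
  unfold alternatingOp
  split_ifs
  · ring
  · rw [Finset.sum_sub_distrib]

theorem alternatingOp_coboundary (τ : X → X) (p d : ℕ) (φ : List X → R) (l : List X) :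
    alternatingOp τ p d (coboundary φ) l = coboundary (alternatingOp τ p d φ) l := by
  unfold alternatingOp
  split_ifs
  · rw [coboundary_sub, coboundary_comp_map τ φ]
  · rw [coboundary_sum]
    exact Finset.sum_congr rfl fun i _ => (coboundary_comp_map _ _ _).symm

theorem alternatingOp_succ_comp (τ : X → X) (p : ℕ) (hτ : τ^[p] = id) (d : ℕ)
    (φ : List X → R) (l : List X) :
    alternatingOp τ p d (alternatingOp τ p (d + 1) φ) l = 0 := by
  have key (m : List X) : ∑ i ∈ range p, φ (m.map τ^[i + 1]) = ∑ i ∈ range p, φ (m.map τ^[i]) := by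
    have h := Finset.sum_range_succ' (fun i => φ (m.map τ^[i])) p
    rw [Finset.sum_range_succ] at h
    simpa [hτ] using h.symm
  unfold alternatingOp
  rcases Nat.even_or_odd d with hd | hd
  · have h1 : ¬ Even (d + 1) := by grind
    simp only [hd, h1, if_true, if_false, List.map_map]
    rw [sub_eq_zero, ← key]
    rfl
  · have h0 : ¬ Even d := by grind
    have h1 : Even (d + 1) := by grind
    simp only [h0, h1, if_true, if_false, List.map_map, Finset.sum_sub_distrib]
    rw [sub_eq_zero, ← key]
    simp only [Function.iterate_succ']

theorem iterCone_sub (τ : X → X) (p : ℕ) (u : ℕ → X → X) (e : ℕ → X) (d : ℕ)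
    (φ ψ : List X → R) :
    iterCone τ p u e d (fun m => φ m - ψ m)
      = iterCone τ p u e d φ - iterCone τ p u e d ψ := by
  induction d generalizing φ ψ with
  | zero => rfl
  | succ d ih =>
    have h1 : cone (u (d + 1)) (e (d + 1)) (fun m => φ m - ψ m)
        = fun m => cone (u (d + 1)) (e (d + 1)) φ m - cone (u (d + 1)) (e (d + 1)) ψ m := by
      ext m
      simp only [cone, prism_sub]
      ring
    simp only [iterCone, ← ih, h1, ← alternatingOp_sub]

theorem iterCone_zero (τ : X → X) (p : ℕ) (u : ℕ → X → X) (e : ℕ → X) (d : ℕ) :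
    iterCone τ p u e d (fun _ => (0 : R)) = 0 := by
  simpa using iterCone_sub τ p u e d (fun _ => (0 : R)) (fun _ => 0)

theorem iterCone_coboundary (τ : X → X) (p : ℕ) (hτ : τ^[p] = id) (u : ℕ → X → X) (e : ℕ → X)
    (d : ℕ) (φ : List X → R) :
    iterCone τ p u e (d + 1) (coboundary φ) = iterCone τ p u e d (alternatingOp τ p d φ) := by
  induction d generalizing φ with
  | zero =>
    simp [iterCone, alternatingOp, cone, prism, coboundary]
  | succ d ih =>
    have h : alternatingOp τ p (d + 1) (cone (u (d + 2)) (e (d + 2)) (coboundary φ))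
        = fun l => alternatingOp τ p (d + 1) φ l
          - coboundary (alternatingOp τ p (d + 1) (cone (u (d + 2)) (e (d + 2)) φ)) l := by
      ext l
      rw [← alternatingOp_coboundary, ← alternatingOp_sub]
      congr 1
      ext m
      exact cone_coboundary _ _ _ _
    rw [iterCone, h, iterCone_sub, ih]
    simp only [funext (alternatingOp_succ_comp τ p hτ d _), iterCone_zero, sub_zero]

theorem prism_eq_zero {r : X → X → Prop} (hr : ∀ x y z, r x y → r y z → r x z) {S S' : Set X}
    {u : X → X} (hS : ∀ x ∈ S, x ∈ S' ∧ u x ∈ S' ∧ r x (u x))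
    (hu : ∀ x ∈ S, ∀ y ∈ S, r x y → r (u x) (u y)) (φ : List X → R) (l : List X)
    (hlS : ∀ x ∈ l, x ∈ S) (hl : l.Pairwise r)
    (hφ : ∀ m : List X, m.length = l.length + 1 → (∀ x ∈ m, x ∈ S') → m.Pairwise r →
      (∀ b, (∀ x ∈ l, r b x) → ∀ x ∈ m, r b x) → φ m = 0) :
    prism u φ l = 0 := by
  induction l generalizing φ with
  | nil => rfl
  | cons a l ih =>
    rw [List.pairwise_cons] at hl
    simp only [List.mem_cons, forall_eq_or_imp] at hlS
    have haS := hS a hlS.1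
    have hmap (b : X) (hb : ∀ x ∈ l, r b x) : ∀ x ∈ l, r b (u x) := fun x hx =>
      hr _ _ _ (hb x hx) (hS x (hlS.2 x hx)).2.2
    rw [prism, ih _ hlS.2 hl.2, sub_zero]
    · apply hφ
      · simp
      · simp only [List.mem_cons, List.mem_map, forall_eq_or_imp, forall_exists_index, and_imp,
          forall_apply_eq_imp_iff₂]
        exact ⟨haS.1, haS.2.1, fun x hx => (hS x (hlS.2 x hx)).2.1⟩
      · simp only [List.pairwise_cons, List.mem_cons, List.mem_map, forall_eq_or_imp,
          forall_exists_index, and_imp, forall_apply_eq_imp_iff₂, List.pairwise_map]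
        exact ⟨⟨haS.2.2, hmap a hl.1⟩, fun x hx => hu _ hlS.1 _ (hlS.2 x hx) (hl.1 x hx),
          hl.2.imp_of_mem fun hx hy h => hu _ (hlS.2 _ hx) _ (hlS.2 _ hy) h⟩
      · simp only [List.mem_cons, List.mem_map, forall_eq_or_imp, forall_exists_index, and_imp,
          forall_apply_eq_imp_iff₂]
        exact fun b hba hb => ⟨hba, hr _ _ _ hba haS.2.2, hmap b hb⟩
    · intro m hlen hmS hm hlow
      apply hφ
      · simp [hlen]
      · simp only [List.mem_cons, forall_eq_or_imp]
        exact ⟨haS.1, hmS⟩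
      · exact List.pairwise_cons.2 ⟨hlow a hl.1, hm⟩
      · simp only [List.mem_cons, forall_eq_or_imp]
        exact fun b hb => ⟨hb.1, hlow b hb.2⟩

/-- The iterated cone of dimension `d` is supported on chains of `d + 1` elements. -/
theorem iterCone_eq_zero {r : X → X → Prop} (hr : ∀ x y z, r x y → r y z → r x z)
    {S : ℕ → Set X} {τ : X → X} (hτS : ∀ d, ∀ x ∈ S d, τ x ∈ S d)
    (hτ : ∀ x y, r x y → r (τ x) (τ y)) {u : ℕ → X → X} {e : ℕ → X} {N : ℕ}
    (he : ∀ d < N, e d ∈ S d)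
    (hS : ∀ d, d + 1 < N → ∀ x ∈ S d,
      x ∈ S (d + 1) ∧ u (d + 1) x ∈ S (d + 1) ∧ r x (u (d + 1) x) ∧ r (e (d + 1)) (u (d + 1) x))
    (hu : ∀ d, d + 1 < N → ∀ x ∈ S d, ∀ y ∈ S d, r x y → r (u (d + 1) x) (u (d + 1) y))
    (p d : ℕ) (hd : d < N) (φ : List X → R)
    (hφ : ∀ l : List X, l.length = d + 1 → (∀ x ∈ l, x ∈ S d) → l.Pairwise r → φ l = 0) :
    iterCone τ p u e d φ = 0 := by
  induction d generalizing φ with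
  | zero => exact hφ _ rfl (by simpa using he 0 hd) (by simp)
  | succ d ih =>
    have hcone (l : List X) (hlen : l.length = d + 1) (hlS : ∀ x ∈ l, x ∈ S d)
        (hl : l.Pairwise r) : cone (u (d + 1)) (e (d + 1)) φ l = 0 := by
      rw [cone, prism_eq_zero hr (S := S d) (S' := S (d + 1))
        (fun x hx => ⟨(hS d hd x hx).1, (hS d hd x hx).2.1, (hS d hd x hx).2.2.1⟩) (hu d hd) φ l hlS
        hl fun m hm hmS hmr _ => hφ m (by rw [hm, hlen]) hmS hmr, sub_zero]
      apply hφ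
      · simp [hlen]
      · simp only [List.mem_cons, List.mem_map, forall_eq_or_imp, forall_exists_index, and_imp,
          forall_apply_eq_imp_iff₂]
        exact ⟨he _ hd, fun x hx => (hS d hd x (hlS x hx)).2.1⟩
      · simp only [List.pairwise_cons, List.mem_map, forall_exists_index, and_imp,
          forall_apply_eq_imp_iff₂, List.pairwise_map]
        exact ⟨fun x hx => (hS d hd x (hlS x hx)).2.2.2,
          hl.imp_of_mem fun hx hy h => hu d hd _ (hlS _ hx) _ (hlS _ hy) h⟩
    have hmap (l : List X) (hlen : l.length = d + 1) (hlS : ∀ x ∈ l, x ∈ S d)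
        (hl : l.Pairwise r) (i : ℕ) :
        cone (u (d + 1)) (e (d + 1)) φ (l.map τ^[i]) = 0 := by
      induction i with
      | zero => simpa using hcone l hlen hlS hl
      | succ i _ =>
        have hiS (j : ℕ) : ∀ x ∈ S d, τ^[j] x ∈ S d := by
          induction j with
          | zero => simp
          | succ j ihj =>
            intro x hx
            rw [Function.iterate_succ_apply']
            exact hτS d _ (ihj x hx)
        have hir (j : ℕ) : ∀ x y, r x y → r (τ^[j] x) (τ^[j] y) := by
          induction j with
          | zero => simp
          | succ j ihj =>
            intro x y hxy
            rw [Function.iterate_succ_apply', Function.iterate_succ_apply']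
            exact hτ _ _ (ihj x y hxy)
        apply hcone
        · simp [hlen]
        · simp only [List.mem_map, forall_exists_index, and_imp, forall_apply_eq_imp_iff₂]
          exact fun x hx => hiS _ x (hlS x hx)
        · rw [List.pairwise_map]
          exact hl.imp fun h => hir _ _ _ h
    refine ih (by omega) _ fun l hlen hlS hl => ?_
    unfold alternatingOp
    split_ifs
    · have h0 := hmap l hlen hlS hl 0
      have h1 := hmap l hlen hlS hl 1
      simp only [Function.iterate_zero, Function.iterate_one, List.map_id] at h0 h1
      rw [h0, h1, sub_zero]
    · exact Finset.sum_eq_zero fun i _ => hmap l hlen hlS hl i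

end Cochain

/-! ### Cocycles on `ZMod p` -/

section Cocycle

variable {p : ℕ}

/-- The indicator of a wrap-around of representatives when passing from `a` to `b`. -/
def wrap (a b : ZMod p) : ℤ := if b.val < a.val then 1 else 0

/-- The carry cocycle, in homogeneous form. -/
def carry (a b c : ZMod p) : ℤ := wrap a b + wrap b c - wrap a c

/-- The even-dimensional cocycles: cup powers of the carry cocycle. -/
def evenCocycle : List (ZMod p) → ZMod p
  | [] => 0
  | [_] => 1
  | [_, _] => 0
  | a :: b :: c :: l => carry a b c * evenCocycle (c :: l)

/-- The odd-dimensional cocycles. -/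
def oddCocycle : List (ZMod p) → ZMod p
  | a :: b :: l => (b - a) * evenCocycle (b :: l)
  | _ => 0

/-- A primitive of `oddCocycle`. -/
def oddPrimitive : List (ZMod p) → ZMod p
  | a :: l => a * evenCocycle (a :: l)
  | [] => 0

/-- A primitive of `evenCocycle` in positive dimensions. -/
def evenPrimitive : List (ZMod p) → ZMod p
  | a :: b :: l => wrap a b * evenCocycle (b :: l)
  | _ => 0

theorem mul_wrap [NeZero p] (a b : ZMod p) :
    (p : ℤ) * wrap a b = ((b - a).val : ℤ) - b.val + a.val := by
  have ha := a.val_lt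
  have hb := b.val_lt
  unfold wrap
  split_ifs with h
  · have h1 := ZMod.val_add (b - a) a
    rw [sub_add_cancel] at h1
    have h2 := (b - a).val_lt
    rcases lt_or_ge ((b - a).val + a.val) p with h3 | h3
    · rw [Nat.mod_eq_of_lt h3] at h1
      omega
    · rw [Nat.mod_eq_sub_mod h3, Nat.mod_eq_of_lt (by omega)] at h1
      omega
  · rw [ZMod.val_sub (by omega)]
    omega

theorem carry_add_right [NeZero p] (a b c g : ZMod p) :
    carry (a + g) (b + g) (c + g) = carry a b c := by
  have hp : (p : ℤ) ≠ 0 := by exact_mod_cast NeZero.ne p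
  apply mul_left_cancel₀ hp
  simp only [carry, mul_add, mul_sub, mul_wrap, add_sub_add_right_eq_sub]
  ring

theorem sum_wrap_add [NeZero p] (a b : ZMod p) :
    ∑ g : ZMod p, wrap (a + g) (b + g) = ((b - a).val : ℤ) := by
  have hp : (p : ℤ) ≠ 0 := by exact_mod_cast NeZero.ne p
  apply mul_left_cancel₀ hp
  have h (c : ZMod p) : ∑ g : ZMod p, ((c + g).val : ℤ) = ∑ g : ZMod p, (g.val : ℤ) :=
    Fintype.sum_equiv (Equiv.addLeft c) _ _ fun _ => rfl
  simp only [Finset.mul_sum, mul_wrap, add_sub_add_right_eq_sub, Finset.sum_add_distrib,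
    Finset.sum_sub_distrib, h]
  simp [ZMod.card]

theorem evenCocycle_map_add [NeZero p] (g : ZMod p) (l : List (ZMod p)) :
    evenCocycle (l.map (· + g)) = evenCocycle l := by
  induction l using evenCocycle.induct with
  | case1 => rfl
  | case2 => rfl
  | case3 => rfl
  | case4 a b c l ih =>
    simp only [List.map_cons, evenCocycle, carry_add_right] at ih ⊢
    rw [ih]

theorem coboundary_evenCocycle (l : List (ZMod p)) (hl : Even l.length) :
    coboundary evenCocycle l = 0 := by
  match l with
  | [] => rfl
  | [_] => simp at hl
  | [a, b] => simp [coboundary, evenCocycle]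
  | [_, _, _] => simp at hl; grind
  | a :: b :: c :: d :: l =>
    have ih := coboundary_evenCocycle (c :: d :: l) (by simp at hl ⊢; grind)
    have h := coboundary_mul_left (carry a b c : ZMod p) (fun m => evenCocycle (c :: m)) (d :: l)
    rw [coboundary] at ih
    rw [coboundary, coboundary, coboundary]
    simp only [evenCocycle]
    rw [h]
    simp only [carry]
    push_cast
    linear_combination ((wrap a b : ZMod p) + wrap b c - wrap a c) * ih

theorem coboundary_oddPrimitive (l : List (ZMod p)) (hl : Even l.length) :
    coboundary oddPrimitive l = oddCocycle l := by
  match l with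
  | [] => rfl
  | [_] => simp at hl
  | a :: b :: l =>
    have ih := coboundary_evenCocycle (a :: b :: l) hl
    have h := coboundary_mul_left a (fun m => evenCocycle (a :: m)) (b :: l)
    rw [coboundary] at ih
    rw [coboundary]
    simp only [oddPrimitive, oddCocycle, h]
    linear_combination a * ih

theorem coboundary_evenPrimitive (a b c : ZMod p) (l : List (ZMod p)) (hl : Even l.length) :
    coboundary evenPrimitive (a :: b :: c :: l) = evenCocycle (a :: b :: c :: l) := by
  have ih := coboundary_evenCocycle (b :: c :: l) (by simp; grind)
  have h := coboundary_mul_left (wrap a b : ZMod p) (fun m => evenCocycle (b :: m)) (c :: l)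
  rw [coboundary] at ih
  rw [coboundary, coboundary]
  simp only [evenPrimitive, evenCocycle, h, carry]
  push_cast
  linear_combination (-(wrap a b : ZMod p)) * ih

theorem isChain_ne_of_evenCocycle_ne_zero (l : List (ZMod p)) (h : evenCocycle l ≠ 0) :
    l.IsChain (· ≠ ·) := by
  induction l using evenCocycle.induct with
  | case1 => simp
  | case2 => simp
  | case3 => simp [evenCocycle] at h
  | case4 a b c l ih =>
    rw [evenCocycle] at h
    have h1 := left_ne_zero_of_mul h
    refine .cons_cons ?_ (.cons_cons ?_ (ih (right_ne_zero_of_mul h)))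
    · rintro rfl
      simp [carry, wrap] at h1
    · rintro rfl
      simp [carry, wrap] at h1

theorem isChain_ne_of_oddCocycle_ne_zero (l : List (ZMod p)) (h : oddCocycle l ≠ 0) :
    l.IsChain (· ≠ ·) := by
  match l with
  | [] => simp
  | [_] => simp
  | a :: b :: l =>
    rw [oddCocycle] at h
    refine .cons_cons ?_ (isChain_ne_of_evenCocycle_ne_zero _ (right_ne_zero_of_mul h))
    rintro rfl
    simp at h

end Cocycle

/-! ### A Tucker lemma for `ZMod p` -/

section Tucker

variable {X : Type*} {p : ℕ} [NeZero p]

theorem sum_evenPrimitive_add (l : List (ZMod p)) :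
    ∑ i ∈ range p, evenPrimitive (l.map (· + (i : ZMod p))) = oddCocycle l := by
  match l with
  | [] => simp [evenPrimitive, oddCocycle]
  | [_] => simp [evenPrimitive, oddCocycle]
  | a :: b :: l =>
    have h1 (g : ZMod p) : evenCocycle ((b + g) :: l.map (· + g)) = evenCocycle (b :: l) :=
      evenCocycle_map_add g (b :: l)
    have h2 : ∑ i ∈ range p, wrap (a + (i : ZMod p)) (b + (i : ZMod p))
        = ∑ g : ZMod p, wrap (a + g) (b + g) := by
      refine Finset.sum_bij (fun i _ => (i : ZMod p)) (by simp) ?_ ?_ (by simp)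
      · intro i hi j hj hij
        rw [Finset.mem_range] at hi hj
        simpa [ZMod.val_cast_of_lt hi, ZMod.val_cast_of_lt hj] using congrArg ZMod.val hij
      · intro g _
        exact ⟨g.val, by simpa using g.val_lt, by simp⟩
    simp only [List.map_cons, evenPrimitive, h1, oddCocycle, ← Finset.sum_mul]
    rw [← Int.cast_sum, h2, sum_wrap_add]
    simp

/-- The cocycles of all dimensions take the value `1` on the iterated cones. -/
theorem iterCone_cocycle {r : X → X → Prop} (hr : ∀ x y z, r x y → r y z → r x z)
    {S : ℕ → Set X} {τ : X → X} (hτp : τ^[p] = id) (hτS : ∀ d, ∀ x ∈ S d, τ x ∈ S d)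
    (hτ : ∀ x y, r x y → r (τ x) (τ y)) {u : ℕ → X → X} {e : ℕ → X} {N : ℕ}
    (he : ∀ d < N, e d ∈ S d)
    (hS : ∀ d, d + 1 < N → ∀ x ∈ S d,
      x ∈ S (d + 1) ∧ u (d + 1) x ∈ S (d + 1) ∧ r x (u (d + 1) x) ∧ r (e (d + 1)) (u (d + 1) x))
    (hu : ∀ d, d + 1 < N → ∀ x ∈ S d, ∀ y ∈ S d, r x y → r (u (d + 1) x) (u (d + 1) y))
    {σ : X → ZMod p} (hσ : ∀ x, σ (τ x) = σ x + 1) (d : ℕ) (hd : d < N) :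
    iterCone τ p u e d
      (fun l => (if Even d then evenCocycle else oddCocycle) (l.map σ)) = 1 := by
  have hcongr (d : ℕ) (hd : d < N) (φ ψ : List X → ZMod p)
      (h : ∀ l : List X, l.length = d + 1 → φ l = ψ l) :
      iterCone τ p u e d φ = iterCone τ p u e d ψ := by
    rw [← sub_eq_zero, ← iterCone_sub]
    exact iterCone_eq_zero hr hτS hτ he hS hu p d hd _ fun l hl _ _ => sub_eq_zero.2 (h l hl)
  have hiter (i : ℕ) (x : X) : σ (τ^[i] x) = σ x + i := by
    induction i with
    | zero => simp
    | succ i ih => rw [Function.iterate_succ_apply', hσ, ih]; push_cast; ring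
  induction d with
  | zero => simp [iterCone, evenCocycle]
  | succ d ih =>
    rw [← ih (by omega)]
    rcases Nat.even_or_odd d with hev | hod
    · have h1 : ¬ Even (d + 1) := by grind
      simp only [hev, h1, if_true, if_false]
      rw [hcongr (d + 1) hd _ (coboundary fun l => oddPrimitive (l.map σ)),
        iterCone_coboundary τ p hτp]
      · apply hcongr d (by omega)
        intro l hl
        simp only [alternatingOp, hev, if_true, List.map_map]
        have h2 : σ ∘ τ = (· + 1) ∘ σ := funext hσ
        rw [h2, ← List.map_map]
        match l with
        | a :: l =>
          have h3 := evenCocycle_map_add 1 (σ a :: l.map σ)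
          simp only [List.map_cons, oddPrimitive] at h3 ⊢
          rw [h3]
          ring
      · intro l hl
        rw [coboundary_comp_map, coboundary_oddPrimitive]
        simp only [List.length_map, hl]
        grind
    · have h0 : ¬ Even d := by grind
      have h1 : Even (d + 1) := by grind
      simp only [h0, h1, if_true, if_false]
      rw [hcongr (d + 1) hd _ (coboundary fun l => evenPrimitive (l.map σ)),
        iterCone_coboundary τ p hτp]
      · congr 1
        ext l
        simp only [alternatingOp, h0, if_false, List.map_map]
        rw [← sum_evenPrimitive_add]
        refine Finset.sum_congr rfl fun i _ => ?_
        rw [List.map_map]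
        congr 2
        exact funext (hiter i)
      · intro l hl
        rw [coboundary_comp_map]
        match l with
        | [_] => simp at hl
        | [_, _] => simp at hl; grind
        | a :: b :: c :: l =>
          simp only [List.map_cons]
          rw [coboundary_evenPrimitive]
          simp at hl ⊢
          grind

theorem exists_pairwise_isChain_ne (hp : 1 < p) {r : X → X → Prop}
    (hr : ∀ x y z, r x y → r y z → r x z)
    {S : ℕ → Set X} {τ : X → X} (hτp : τ^[p] = id) (hτS : ∀ d, ∀ x ∈ S d, τ x ∈ S d)
    (hτ : ∀ x y, r x y → r (τ x) (τ y)) {u : ℕ → X → X} {e : ℕ → X} {N : ℕ}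
    (he : ∀ d < N, e d ∈ S d)
    (hS : ∀ d, d + 1 < N → ∀ x ∈ S d,
      x ∈ S (d + 1) ∧ u (d + 1) x ∈ S (d + 1) ∧ r x (u (d + 1) x) ∧ r (e (d + 1)) (u (d + 1) x))
    (hu : ∀ d, d + 1 < N → ∀ x ∈ S d, ∀ y ∈ S d, r x y → r (u (d + 1) x) (u (d + 1) y))
    {σ : X → ZMod p} (hσ : ∀ x, σ (τ x) = σ x + 1) :
    ∃ l : List X, l.length = N ∧ l.Pairwise r ∧ l.IsChain (fun x y => σ x ≠ σ y) := by
  rcases N.eq_zero_or_pos with rfl | hN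
  · exact ⟨[], by simp⟩
  have : Fact (1 < p) := ⟨hp⟩
  by_contra! hcon
  have h := iterCone_cocycle hr hτp hτS hτ he hS hu hσ (N - 1) (by omega)
  rw [iterCone_eq_zero hr hτS hτ he hS hu p (N - 1) (by omega)] at h
  · exact zero_ne_one h
  · intro l hl _ hlr
    have hnot := hcon l (by omega) hlr
    by_contra hne
    apply hnot
    rw [← List.isChain_map σ (R := (· ≠ ·))]
    split_ifs at hne
    · exact isChain_ne_of_evenCocycle_ne_zero _ hne
    · exact isChain_ne_of_oddCocycle_ne_zero _ hne

/-- The partial map `y` extends the partial map `x`. -/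
def Extends {N : ℕ} (x y : Fin N → Option (ZMod p)) : Prop := ∀ i, x i ≠ none → y i = x i

/-- A `ZMod p`-valued equivariant labelling of the nonempty partial maps `Fin N → ZMod p` changes
its value at each step along some chain of `N` partial maps. -/
theorem exists_chain_of_equivariant (hp : 1 < p) (N : ℕ)
    (σ : (Fin N → Option (ZMod p)) → ZMod p)
    (hσ : ∀ x, (∃ i, x i ≠ none) → σ (fun i => (x i).map (· + 1)) = σ x + 1) :
    ∃ l : List (Fin N → Option (ZMod p)), l.length = N ∧ (∀ x ∈ l, ∃ i, x i ≠ none) ∧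
      l.Pairwise Extends ∧ l.IsChain (fun x y => σ x ≠ σ y) := by
  rcases N with _ | M
  · exact ⟨[], by simp⟩
  let X := {x : Fin (M + 1) → Option (ZMod p) // ∃ i, x i ≠ none}
  let τ : X → X := fun x => ⟨fun i => (x.1 i).map (· + 1), by simpa using x.2⟩
  let u : ℕ → X → X := fun d x =>
    ⟨Function.update x.1 (Fin.ofNat (M + 1) d) (some 0), Fin.ofNat (M + 1) d, by simp⟩
  let e : ℕ → X := fun d =>
    ⟨Function.update (fun _ => none) (Fin.ofNat (M + 1) d) (some 0), Fin.ofNat (M + 1) d, by simp⟩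
  let S : ℕ → Set X := fun d => {x | ∀ i : Fin (M + 1), d < i.val → x.1 i = none}
  have hτi (j : ℕ) (x : X) (i : Fin (M + 1)) : (τ^[j] x).1 i = (x.1 i).map (· + (j : ZMod p)) := by
    induction j with
    | zero => simp
    | succ j ih =>
      rw [Function.iterate_succ_apply']
      simp only [τ] at ih ⊢
      rw [ih]
      cases x.1 i <;> simp [add_assoc]
  have hval (d : ℕ) (hd : d < M + 1) (i : Fin (M + 1)) : i = Fin.ofNat (M + 1) d ↔ i.val = d := by
    rw [Fin.ext_iff]
    simp [Nat.mod_eq_of_lt hd]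
  obtain ⟨l, hl, hlr, hlc⟩ := exists_pairwise_isChain_ne (X := X) hp
    (r := fun x y => Extends x.1 y.1) (S := S) (τ := τ) (u := u) (e := e) (N := M + 1)
    (σ := fun x => σ x.1)
    (by
      intro x y z hxy hyz i hi
      rw [← hxy i hi]
      exact hyz i (by rw [hxy i hi]; exact hi))
    (by
      funext x
      apply Subtype.ext
      funext i
      rw [hτi]
      simp)
    (by
      intro d x hx i hi
      simp only [τ, hx i hi, Option.map_none])
    (by
      intro x y hxy i hi
      simp only [τ, ne_eq, Option.map_eq_none_iff] at hi ⊢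
      rw [hxy i hi])
    (by
      intro d hd i hi
      have h := hval d hd i
      simp only [e]
      rw [Function.update_of_ne]
      rw [ne_eq, h]
      omega)
    (by
      intro d hd x hx
      refine ⟨fun i hi => hx i (by omega), fun i hi => ?_, fun i hi => ?_, fun i hi => ?_⟩
      · have h := hval (d + 1) hd i
        simp only [u]
        rw [Function.update_of_ne (by rw [ne_eq, h]; omega)]
        exact hx i (by omega)
      · have h := hval (d + 1) hd i
        simp only [u]
        rw [Function.update_of_ne]
        rw [ne_eq, h]
        intro hid
        exact hi (hx i (by omega))
      · simp only [u, e] at hi ⊢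
        by_cases h : i = Fin.ofNat (M + 1) (d + 1)
        · rw [h]
          simp
        · rw [Function.update_of_ne h] at hi
          exact absurd rfl hi)
    (by
      intro d _ x _ y _ hxy i hi
      simp only [u] at hi ⊢
      by_cases h : i = Fin.ofNat (M + 1) (d + 1)
      · rw [h]
        simp
      · rw [Function.update_of_ne h] at hi ⊢
        rw [Function.update_of_ne h]
        exact hxy i hi)
    (fun x => hσ x.1 x.2)
  refine ⟨l.map Subtype.val, by simpa using hl, ?_, ?_, ?_⟩
  · simp only [List.mem_map, forall_exists_index, and_imp, forall_apply_eq_imp_iff₂]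
    exact fun x _ => x.2
  · exact List.pairwise_map.2 hlr
  · exact (List.isChain_map _).2 hlc

end Tucker

/-! ### Monochromatic families of sets with bounded multiplicities -/

section Families

/-- `HasMonoFamily r` says that any coloring by `t` colors of the `(κ + 1)`-subsets of a finite type
has `r` sets of the same color covering each point `i` at most `s i ≤ r` times, as soon as
`∑ i, s i > r * κ + t * (r - 1)`. -/
def HasMonoFamily (r : ℕ) : Prop :=
  ∀ (ι : Type) [Fintype ι] [DecidableEq ι] (s : ι → ℕ) (κ t : ℕ) (c : Finset ι → ℕ),
    (∀ A, #A = κ + 1 → c A < t) → (∀ i, s i ≤ r) → r * κ + t * (r - 1) < ∑ i, s i →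
    ∃ (A : Fin r → Finset ι) (a : ℕ), (∀ j, #(A j) = κ + 1 ∧ c (A j) = a) ∧
      ∀ i, #{j | i ∈ A j} ≤ s i

/-- Equivariant labels for nonconstant functions on `ZMod p`. -/
theorem exists_equivariant_label (p : ℕ) [Fact p.Prime] (β : Type*) :
    ∃ f : (ZMod p → β) → ZMod p, ∀ y : ZMod p → β, (∀ b, ∃ j, y j ≠ b) →
      f (fun j => y (j - 1)) = f y + 1 := by
  let rel : Setoid (ZMod p → β) :=
    { r := fun y z => ∃ g, ∀ j, y j = z (j - g)
      iseqv :=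
        { refl := fun y => ⟨0, by simp⟩
          symm := by
            rintro y z ⟨g, hg⟩
            exact ⟨-g, fun j => by rw [hg]; simp⟩
          trans := by
            rintro x y z ⟨g, hg⟩ ⟨h, hh⟩
            exact ⟨g + h, fun j => by rw [hg, hh, sub_sub]⟩ } }
  have hrep (y : ZMod p → β) : ∃ g, ∀ j, y j = (Quotient.out (Quotient.mk rel y)) (j - g) :=
    rel.symm (Quotient.mk_out y)
  choose f hf using hrep
  refine ⟨f, fun y hy => ?_⟩
  have hcls : Quotient.mk rel (fun j => y (j - 1)) = Quotient.mk rel y :=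
    Quotient.sound ⟨1, fun j => rfl⟩
  have h1 := hf (fun j => y (j - 1))
  rw [hcls] at h1
  have h2 := hf y
  set z := Quotient.out (Quotient.mk rel y)
  by_contra hne
  set h := f (fun j => y (j - 1)) - (f y + 1) with hh
  have hh0 : h ≠ 0 := sub_ne_zero.2 hne
  have hper (j : ZMod p) : z (j + h) = z j := by
    have h3 := h1 (j + f (fun j => y (j - 1)))
    rw [h2] at h3
    rw [add_sub_cancel_right] at h3
    rw [← h3, hh]
    congr 1
    ring
  have hmul (m : ℕ) : z (m * h) = z 0 := by
    induction m with
    | zero => simp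
    | succ m ih => rw [← ih, ← hper (m * h)]; push_cast; congr 1; ring
  obtain ⟨j, hj⟩ := hy (z 0)
  apply hj
  rw [h2, ← hmul ((j - f y) / h).val, ZMod.natCast_zmod_val, div_mul_cancel₀ _ hh0]

theorem length_le_of_isChain_lt {l : List ℕ} {m : ℕ} (hl : l.IsChain (· < ·))
    (hm : ∀ x ∈ l, 1 ≤ x ∧ x ≤ m) : l.length ≤ m := by
  have hnd : l.Nodup := (List.isChain_iff_pairwise.1 hl).imp ne_of_lt
  rw [← List.toFinset_card_of_nodup hnd]
  calc l.toFinset.card ≤ #(Icc 1 m) := card_le_card fun x hx => by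
        rw [mem_Icc]; exact hm x (List.mem_toFinset.1 hx)
    _ = m := by simp

theorem sum_card_le_of_exists_notMem {J : Type*} [Fintype J] (Y : J → Finset ℕ) (t : ℕ)
    (ht : ∀ j, Y j ⊆ range t) (hY : ∀ a, ∃ j, a ∉ Y j) :
    ∑ j, #(Y j) ≤ t * (Fintype.card J - 1) := by
  classical
  have h := sum_card_bipartiteAbove_eq_sum_card_bipartiteBelow (s := (univ : Finset J))
    (t := range t) (fun j a => a ∈ Y j)
  have h1 (j : J) : bipartiteAbove (fun j a => a ∈ Y j) (range t) j = Y j := by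
    ext a
    simp only [bipartiteAbove, mem_filter]
    exact ⟨fun h => h.2, fun h => ⟨ht j h, h⟩⟩
  simp only [h1] at h
  rw [h]
  calc _ ≤ ∑ _a ∈ range t, (Fintype.card J - 1) := sum_le_sum fun a _ => by
        obtain ⟨j, hj⟩ := hY a
        apply Nat.le_sub_one_of_lt
        refine card_lt_univ_of_notMem (x := j) ?_
        simpa [bipartiteBelow] using hj
    _ = _ := by simp

theorem one_le_sum_card {J α : Type*} [Fintype J] {C : J → Finset α} (h : ∃ j a, a ∈ C j) :
    1 ≤ ∑ j, #(C j) := by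
  obtain ⟨j, a, ha⟩ := h
  exact le_trans (card_pos.2 ⟨a, ha⟩) (single_le_sum (f := fun j => #(C j)) (by simp) (mem_univ j))

theorem eq_of_subset_of_sum_card_le {J α : Type*} [Fintype J] {B C : J → Finset α}
    (h : ∀ j, B j ⊆ C j) (hc : ∑ j, #(C j) ≤ ∑ j, #(B j)) : B = C := by
  have h1 : ∀ j ∈ univ, #(B j) ≤ #(C j) := fun j _ => card_le_card (h j)
  have h2 := (sum_eq_sum_iff_of_le h1).1 (le_antisymm (sum_le_sum h1) hc)
  funext j
  exact eq_of_subset_of_card_le (h j) (h2 j (mem_univ j)).ge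

theorem exists_monoFamily_of_lt_prime {p : ℕ} [Fact p.Prime] {ι : Type*} [Fintype ι]
    [DecidableEq ι] (s : ι → ℕ) (κ t : ℕ) (c : Finset ι → ℕ) (hc : ∀ A, #A = κ + 1 → c A < t)
    (hs : ∀ i, s i < p) (hsum : p * κ + t * (p - 1) < ∑ i, s i) :
    ∃ (A : ZMod p → Finset ι) (a : ℕ), (∀ j, #(A j) = κ + 1 ∧ c (A j) = a) ∧
      ∀ i, #{j | i ∈ A j} ≤ s i := by
  classical
  by_contra! hno
  set N := ∑ i, s i
  let ε : (Σ i, Fin (s i)) ≃ Fin N := Fintype.equivFinOfCardEq (by simp [N])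
  let pr : Fin N → ι := fun q => (ε.symm q).1
  have hpr (i : ι) : #{q | pr q = i} ≤ s i := by
    calc #{q | pr q = i} ≤ #((univ : Finset (Fin (s i))).image fun a => ε ⟨i, a⟩) := by
          apply card_le_card
          intro q hq
          simp only [mem_filter, mem_univ, true_and, pr] at hq
          subst hq
          simp only [mem_image, mem_univ, true_and]
          exact ⟨(ε.symm q).2, by simp⟩
      _ ≤ #(univ : Finset (Fin (s i))) := card_image_le
      _ = s i := by simp
  let B : (Fin N → Option (ZMod p)) → ZMod p → Finset ι := fun x j =>
    ({q | x q = some j} : Finset (Fin N)).image pr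
  let Y : (Fin N → Option (ZMod p)) → ZMod p → Finset ℕ := fun x j =>
    (powersetCard (κ + 1) (B x j)).image c
  have hBcount (x) (i : ι) : #{j | i ∈ B x j} ≤ s i := by
    refine le_trans ?_ (hpr i)
    refine le_trans (card_le_card ?_)
      (card_image_le (s := ({q | pr q = i} : Finset (Fin N))) (f := fun q => (x q).getD 0))
    intro j hj
    simp only [B, mem_filter, mem_univ, true_and, mem_image] at hj ⊢
    obtain ⟨q, hq, hqi⟩ := hj
    exact ⟨q, hqi, by simp [hq]⟩
  have hYmiss (x) (a : ℕ) : ∃ j, a ∉ Y x j := by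
    by_contra! h
    simp only [Y, mem_image, mem_powersetCard] at h
    choose A hA hAc using h
    obtain ⟨i, hi⟩ := hno A a fun j => ⟨(hA j).2, hAc j⟩
    refine absurd (le_trans (card_le_card ?_) (hBcount x i)) hi.not_ge
    intro j hj
    simp only [mem_filter, mem_univ, true_and] at hj ⊢
    exact (hA j).1 hj
  have hYt (x j) : Y x j ⊆ range t := by
    intro a ha
    simp only [Y, mem_image, mem_powersetCard] at ha
    obtain ⟨A, hA, rfl⟩ := ha
    exact mem_range.2 (hc A hA.2)
  have hBmono {x y} (h : Extends x y) (j) : B x j ⊆ B y j := by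
    refine image_subset_image fun q hq => ?_
    simp only [mem_filter, mem_univ, true_and] at hq ⊢
    rw [h q (by simp [hq]), hq]
  have hYmono {x y} (h : Extends x y) (j) : Y x j ⊆ Y y j :=
    image_subset_image (powersetCard_mono (hBmono h j))
  have hBne {x} (hx : ∃ q, x q ≠ none) : ∃ j i, i ∈ B x j := by
    obtain ⟨q, hq⟩ := hx
    obtain ⟨j, hj⟩ := Option.ne_none_iff_exists'.1 hq
    exact ⟨j, pr q, mem_image_of_mem _ (by simpa using hj)⟩
  have hYne {x} (hx : ¬ ∀ j, #(B x j) ≤ κ) : ∃ j a, a ∈ Y x j := by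
    push Not at hx
    obtain ⟨j, hj⟩ := hx
    obtain ⟨A, hA, hAc⟩ := exists_subset_card_eq (Nat.succ_le_of_lt hj)
    exact ⟨j, c A, mem_image_of_mem _ (mem_powersetCard.2 ⟨hA, hAc⟩)⟩
  have hBsum {x} (hx : ∀ j, #(B x j) ≤ κ) : ∑ j, #(B x j) ≤ p * κ := by
    simpa [ZMod.card] using sum_le_card_nsmul univ _ κ fun j _ => hx j
  obtain ⟨f, hf⟩ := exists_equivariant_label p (Finset ι)
  obtain ⟨g, hg⟩ := exists_equivariant_label p (Finset ℕ)
  let rank : (Fin N → Option (ZMod p)) → ℕ := fun x =>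
    if ∀ j, #(B x j) ≤ κ then ∑ j, #(B x j) else p * κ + ∑ j, #(Y x j)
  let σ : (Fin N → Option (ZMod p)) → ZMod p := fun x =>
    if ∀ j, #(B x j) ≤ κ then f (B x) else g (Y x)
  have hσ (x : Fin N → Option (ZMod p)) (hx : ∃ i, x i ≠ none) :
      σ (fun i => (x i).map (· + 1)) = σ x + 1 := by
    have hB : B (fun i => (x i).map (· + 1)) = fun j => B x (j - 1) := by
      funext j
      simp only [B, Option.map_eq_some_iff]
      congr 1
      ext q
      simp only [mem_filter, mem_univ, true_and]
      constructor
      · rintro ⟨a, ha, rfl⟩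
        simpa using ha
      · intro h
        exact ⟨j - 1, h, by simp⟩
    have hY : Y (fun i => (x i).map (· + 1)) = fun j => Y x (j - 1) := by
      funext j
      simp only [Y, hB]
    have hiff : (∀ j, #(B x (j - 1)) ≤ κ) ↔ ∀ j, #(B x j) ≤ κ :=
      ⟨fun h j => by simpa using h (j + 1), fun h j => h _⟩
    simp only [σ, hY, hB, hiff]
    split_ifs with h
    · refine hf _ fun b => ?_
      by_contra! hcon
      obtain ⟨j, i, hi⟩ := hBne hx
      have h1 := hBcount x i
      rw [filter_true_of_mem (fun j' _ => by rw [hcon j', ← hcon j]; exact hi), card_univ,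
        ZMod.card] at h1
      exact absurd (hs i) h1.not_gt
    · refine hg _ fun b => ?_
      by_contra! hcon
      obtain ⟨j, a, ha⟩ := hYne h
      obtain ⟨j', hj'⟩ := hYmiss x a
      exact hj' (by rw [hcon j', ← hcon j]; exact ha)
  have hrank_bound (x : Fin N → Option (ZMod p)) (hx : ∃ i, x i ≠ none) :
      1 ≤ rank x ∧ rank x ≤ p * κ + t * (p - 1) := by
    simp only [rank]
    split_ifs with h
    · exact ⟨one_le_sum_card (hBne hx), (hBsum h).trans (Nat.le_add_right _ _)⟩
    · have h1 := sum_card_le_of_exists_notMem (Y x) t (hYt x) (hYmiss x)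
      rw [ZMod.card] at h1
      have h2 := one_le_sum_card (hYne h)
      exact ⟨by linarith [Nat.zero_le (p * κ)], by linarith⟩
  have hrank_lt {x y : Fin N → Option (ZMod p)} (hxy : Extends x y) (hne : σ x ≠ σ y) :
      rank x < rank y := by
    by_contra! hle
    apply hne
    by_cases hx : ∀ j, #(B x j) ≤ κ <;> by_cases hy : ∀ j, #(B y j) ≤ κ
    · simp only [rank, σ, if_pos hx, if_pos hy] at hle ⊢
      rw [eq_of_subset_of_sum_card_le (hBmono hxy) hle]
    · simp only [rank, if_pos hx, if_neg hy] at hle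
      have h1 := hBsum hx
      have h2 := one_le_sum_card (hYne hy)
      omega
    · exact absurd (fun j => (card_le_card (hBmono hxy j)).trans (hy j)) hx
    · simp only [rank, σ, if_neg hx, if_neg hy] at hle ⊢
      rw [eq_of_subset_of_sum_card_le (hYmono hxy) (by omega)]
  obtain ⟨l, hl, hlne, hlr, hlc⟩ :=
    exists_chain_of_equivariant (Fact.out : p.Prime).one_lt N σ hσ
  have hchain : (l.map rank).IsChain (· < ·) := by
    rw [List.isChain_map, List.isChain_iff_getElem]
    rw [List.isChain_iff_getElem] at hlc
    rw [List.pairwise_iff_getElem] at hlr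
    exact fun i hi => hrank_lt (hlr i (i + 1) (by omega) hi (by omega)) (hlc i hi)
  have h := length_le_of_isChain_lt (m := p * κ + t * (p - 1)) hchain (by
    simp only [List.mem_map, forall_exists_index, and_imp, forall_apply_eq_imp_iff₂]
    exact fun x hx => hrank_bound x (hlne x hx))
  rw [List.length_map, hl] at h
  omega


theorem exists_monoFamily_fin {J ι : Type*} [Fintype J] [DecidableEq ι] {r : ℕ}
    (hJ : Fintype.card J = r) {s : ι → ℕ} {κ : ℕ} {c : Finset ι → ℕ}
    (h : ∃ (A : J → Finset ι) (a : ℕ), (∀ j, #(A j) = κ + 1 ∧ c (A j) = a) ∧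
      ∀ i, #{j | i ∈ A j} ≤ s i) :
    ∃ (A : Fin r → Finset ι) (a : ℕ), (∀ j, #(A j) = κ + 1 ∧ c (A j) = a) ∧
      ∀ i, #{j | i ∈ A j} ≤ s i := by
  obtain ⟨A, a, hA, hAs⟩ := h
  let ε := Fintype.equivFinOfCardEq hJ
  refine ⟨A ∘ ε.symm, a, fun j => hA _, fun i => le_trans (le_of_eq ?_) (hAs i)⟩
  exact card_equiv ε.symm (by simp)

theorem hasMonoFamily_zero : HasMonoFamily 0 := by
  intro ι _ _ s κ t c _ hs hsum
  simp [Nat.le_zero.1 (hs _)] at hsum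

theorem hasMonoFamily_one : HasMonoFamily 1 := by
  intro ι _ _ s κ t c _ hs hsum
  have h : κ + 1 ≤ #{i | s i = 1} := by
    rw [card_filter]
    have h1 : ∑ i, s i = ∑ i, if s i = 1 then 1 else 0 :=
      sum_congr rfl fun i _ => by have := hs i; split_ifs <;> omega
    omega
  obtain ⟨A, hA, hAc⟩ := exists_subset_card_eq h
  refine ⟨fun _ => A, c A, fun _ => ⟨hAc, rfl⟩, fun i => ?_⟩
  by_cases hi : i ∈ A
  · have h1 : s i = 1 := by simpa using hA hi
    simp [hi, h1]
  · simp [hi]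

theorem hasMonoFamily_of_prime {p : ℕ} (hp : p.Prime) : HasMonoFamily p := by
  intro ι _ _ s κ t c hc hs hsum
  have : Fact p.Prime := ⟨hp⟩
  apply exists_monoFamily_fin (ZMod.card p)
  set F : Finset ι := {i | s i = p} with hF
  have hcount (A : ZMod p → Finset ι) (i : ι) : #{j | i ∈ A j} ≤ p := by
    simpa [ZMod.card] using card_le_univ ({j | i ∈ A j} : Finset (ZMod p))
  rcases le_or_gt (κ + 1) #F with hcard | hcard
  · obtain ⟨A, hA, hAc⟩ := exists_subset_card_eq hcard
    refine ⟨fun _ => A, c A, fun _ => ⟨hAc, rfl⟩, fun i => ?_⟩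
    by_cases hi : i ∈ A
    · have h1 : s i = p := by simpa [hF] using hA hi
      rw [h1]
      exact hcount _ i
    · simp [hi]
  · let emb : {i // s i < p} ↪ ι := Function.Embedding.subtype _
    have hdisj (A : Finset {i // s i < p}) : Disjoint F (A.map emb) := by
      rw [disjoint_left]
      intro i hi hiA
      obtain ⟨⟨b, hb⟩, _, rfl⟩ := mem_map.1 hiA
      simp only [hF, mem_filter, mem_univ, true_and, emb, Function.Embedding.subtype_apply] at hi
      omega
    have hunion (A : Finset {i // s i < p}) (hA : #A = κ - #F + 1) :
        #(F ∪ A.map emb) = κ + 1 := by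
      rw [card_union_of_disjoint (hdisj A), card_map, hA]
      omega
    have hsplit : ∑ i, s i = #F * p + ∑ i : {i // s i < p}, s i := by
      rw [← sum_filter_add_sum_filter_not univ (fun i => s i = p)]
      congr 1
      · rw [sum_congr rfl (g := fun _ => p) (fun i hi => (mem_filter.1 hi).2)]
        simp [hF]
      · rw [← sum_subtype (p := fun i => s i < p) ({i | ¬ s i = p} : Finset ι)]
        intro i
        have := hs i
        simp only [mem_filter, mem_univ, true_and]
        omega
    obtain ⟨A, a, hA, hAs⟩ := exists_monoFamily_of_lt_prime (p := p)
      (fun i : {i // s i < p} => s i) (κ - #F) t (fun A => c (F ∪ A.map emb))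
      (fun A hA => hc _ (hunion A hA)) (fun i => i.2) (by
        have h1 : p * κ = p * (κ - #F) + #F * p := by
          rw [mul_comm (#F) p, ← mul_add]
          congr 1
          omega
        omega)
    refine ⟨fun j => F ∪ (A j).map emb, a, fun j => ⟨hunion _ (hA j).1, (hA j).2⟩, fun i => ?_⟩
    rcases (hs i).lt_or_eq with hi | hi
    · refine le_trans (card_le_card fun j hj => ?_) (hAs ⟨i, hi⟩)
      simp only [hF, mem_filter, mem_univ, true_and, mem_union, mem_map] at hj ⊢
      rcases hj with hj | ⟨b, hb, rfl⟩
      · omega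
      · exact hb
    · rw [hi]
      exact hcount _ i

theorem sum_range_min_sub (m r a : ℕ) : ∑ q ∈ range m, min r (a - q * r) = min (m * r) a := by
  induction m with
  | zero => simp
  | succ m ih =>
    rw [sum_range_succ, ih, add_mul, one_mul]
    omega

theorem HasMonoFamily.mul {r₁ r₂ : ℕ} (h₁ : HasMonoFamily r₁) (h₂ : HasMonoFamily r₂)
    (hr₁ : 1 ≤ r₁) (hr₂ : 1 ≤ r₂) : HasMonoFamily (r₁ * r₂) := by
  intro ι _ _ s κ t c hc hs hsum
  apply exists_monoFamily_fin (J := Fin r₂ × Fin r₁) (by simp [mul_comm])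
  have hinner (T : Finset (ι × Fin r₁)) (hT : #T = r₁ * κ + t * (r₁ - 1) + 1) :
      ∃ (A : Fin r₁ → Finset ι) (a : ℕ), (∀ j, #(A j) = κ + 1 ∧ c (A j) = a) ∧
        ∀ i, #{j | i ∈ A j} ≤ #{q | (i, q) ∈ T} := by
    refine h₁ ι (fun i => #{q | (i, q) ∈ T}) κ t c hc (fun i => ?_) ?_
    · simpa using card_le_univ ({q | (i, q) ∈ T} : Finset (Fin r₁))
    · have h : #T = ∑ i, #{q | (i, q) ∈ T} := by
        simp only [card_filter]
        rw [← Fintype.sum_prod_type' (fun i q => if (i, q) ∈ T then 1 else 0)]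
        simp
      omega
  choose! A a hA hAs using hinner
  obtain ⟨T, b, hT, hTs⟩ := h₂ (ι × Fin r₁) (fun x => min r₂ (s x.1 - x.2 * r₂))
    (r₁ * κ + t * (r₁ - 1)) t a
    (fun T hT => by
      have h := hA T hT ⟨0, hr₁⟩
      rw [← h.2]
      exact hc _ h.1)
    (fun x => min_le_left _ _) (by
      rw [Fintype.sum_prod_type]
      have h1 (i : ι) : ∑ q : Fin r₁, min r₂ (s i - q * r₂) = s i := by
        rw [Fin.sum_univ_eq_sum_range (fun q => min r₂ (s i - q * r₂)), sum_range_min_sub]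
        exact min_eq_right (hs i)
      simp only [h1]
      refine lt_of_eq_of_lt ?_ hsum
      obtain ⟨x, rfl⟩ := Nat.exists_eq_add_of_le' hr₁
      obtain ⟨y, rfl⟩ := Nat.exists_eq_add_of_le' hr₂
      have h2 : (x + 1) * (y + 1) - 1 = x * y + x + y := by
        rw [show (x + 1) * (y + 1) = x * y + x + y + 1 by ring]
        rfl
      rw [h2]
      simp only [Nat.add_sub_cancel]
      ring)
  refine ⟨fun x => A (T x.1) x.2, b, fun x => ?_, fun i => ?_⟩
  · have h := hA (T x.1) (hT x.1).1 x.2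
    exact ⟨h.1, h.2.trans (hT x.1).2⟩
  · calc #{x : Fin r₂ × Fin r₁ | i ∈ A (T x.1) x.2}
        = ∑ j, #{l | i ∈ A (T j) l} := by
          simp only [card_filter]
          rw [Fintype.sum_prod_type]
      _ ≤ ∑ j, #{q | (i, q) ∈ T j} := sum_le_sum fun j _ => hAs _ (hT j).1 i
      _ = ∑ q, #{j | (i, q) ∈ T j} := by
          simp only [card_filter]
          exact sum_comm
      _ ≤ ∑ q : Fin r₁, min r₂ (s i - q * r₂) := sum_le_sum fun q _ => hTs (i, q)
      _ = s i := by
          rw [Fin.sum_univ_eq_sum_range (fun q => min r₂ (s i - q * r₂)), sum_range_min_sub]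
          exact min_eq_right (hs i)

theorem hasMonoFamily (r : ℕ) : HasMonoFamily r := by
  induction r using Nat.recOnMul with
  | zero => exact hasMonoFamily_zero
  | one => exact hasMonoFamily_one
  | prime p hp => exact hasMonoFamily_of_prime hp
  | mul a b ha hb =>
    rcases a.eq_zero_or_pos with rfl | ha0
    · simpa using hasMonoFamily_zero
    rcases b.eq_zero_or_pos with rfl | hb0
    · simpa using hasMonoFamily_zero
    exact ha.mul hb ha0 hb0

end Families

theorem chromatic_KGS_ge (n k r : ℕ) (s : Fin n → ℕ)
    (hk : 1 ≤ k) (hr : 2 ≤ r) (hs : ∀ i, s i ≤ r) (hsum : r * k ≤ ∑ i, s i) :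
    (((∑ i, s i) - r * (k - 1)) ⌈/⌉ (r - 1) : ℕ) ≤ hypChromatic (KGSEdges n k r s) := by
  classical
  obtain ⟨κ, rfl⟩ := Nat.exists_eq_add_of_le' hk
  refine le_sInf ?_
  rintro _ ⟨t, rfl, c, hc⟩
  rw [Nat.cast_le, ceilDiv_le_iff_le_mul (by omega)]
  by_contra! hlt
  let c' : Finset (Fin n) → ℕ := fun A => if h : #A = κ + 1 then (c ⟨A, h⟩).val else 0
  obtain ⟨A, a, hA, hAs⟩ := hasMonoFamily r (Fin n) s κ t c'
    (fun A hA => by simp [c', hA]) hs (by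
      simp only [Nat.add_sub_cancel] at hlt
      rw [mul_comm t]
      omega)
  let V : Fin r → KGSVertex n (κ + 1) := fun j => ⟨A j, (hA j).1⟩
  have hV (j : Fin r) : (c (V j)).val = a := by
    have h := (hA j).2
    simpa only [c', (hA j).1, dif_pos] using h
  obtain ⟨x, hx, y, hy, hne⟩ := hc (univ.val.map V) (by
    refine ⟨by simp, fun i => le_trans (le_of_eq ?_) (hAs i)⟩
    rw [Multiset.filter_map, Multiset.card_map]
    rfl)
  obtain ⟨j, _, rfl⟩ := Multiset.mem_map.1 hx
  obtain ⟨l, _, rfl⟩ := Multiset.mem_map.1 hy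
  exact hne (Fin.ext ((hV j).trans (hV l).symm))
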